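/- arXiv:1005.4258 — 2 statements merged into one kernel-verified Lean document; each statement's English description precedes it below -/
import Mathlib

section
/- For every positive integer m, multi-indices n, z ∈ ℕ^m, and natural numbers p, q with p ≥ n·z and q ≥ 1, one has ∑_{k=0}^{n} C(p − k·z, k) · C(q + k·z, n − k) = ∑_{k=0}^{n} C(p + 1 − k·z, k) · C(q − 1 + k·z, n − k), where the multinomial coefficients are evaluated at the (possibly negative) integers p − k·z and p + 1 − k·z via the polynomial definition below. -/
/-- The multinomial coefficient `C(x, k) = x(x-1)⋯(x-|k|+1)/k!` for `x : ℂ`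
and a multi-index `k : Fin m → ℕ`. -/
noncomputable def mchoose {m : ℕ} (x : ℂ) (k : Fin m → ℕ) : ℂ :=
  (∏ j ∈ Finset.range (∑ i, k i), (x - (j : ℂ))) / ∏ i, (Nat.factorial (k i) : ℂ)

/-- The dot product `k·z = k₁z₁ + ⋯ + kₘzₘ` of multi-indices. -/
def mdot {m : ℕ} (k z : Fin m → ℕ) : ℕ := ∑ i, k i * z i

theorem prod_range_add_one_sub (x : ℂ) (d : ℕ) :
    ∏ j ∈ Finset.range d, (x + 1 - (j : ℂ)) =
      ∏ j ∈ Finset.range d, (x - (j : ℂ)) + d * ∏ j ∈ Finset.range (d - 1), (x - (j : ℂ)) := by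
  cases d with
  | zero => simp
  | succ d =>
    rw [Finset.prod_range_succ', Finset.prod_range_succ]
    have h : ∏ j ∈ Finset.range d, (x + 1 - ((j + 1 : ℕ) : ℂ)) =
        ∏ j ∈ Finset.range d, (x - (j : ℂ)) :=
      Finset.prod_congr rfl fun j _ => by push_cast; ring
    rw [h, Nat.add_sub_cancel]
    push_cast
    ring

theorem mchoose_add_single {m : ℕ} (x : ℂ) (l : Fin m → ℕ) (i : Fin m) :
    ((l i : ℂ) + 1) * (∏ j ∈ Finset.range (∑ i, l i), (x - (j : ℂ))) /
        ∏ j, (Nat.factorial ((l + Pi.single i 1 : Fin m → ℕ) j) : ℂ) = mchoose x l := by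
  have h : ∏ j, (Nat.factorial ((l + Pi.single i 1 : Fin m → ℕ) j) : ℂ) =
      ((l i : ℂ) + 1) * ∏ j, (Nat.factorial (l j) : ℂ) := by
    rw [← Finset.mul_prod_erase _ _ (Finset.mem_univ i),
      ← Finset.mul_prod_erase (a := i) _ (fun j => (Nat.factorial (l j) : ℂ)) (Finset.mem_univ i)]
    rw [Finset.prod_congr rfl (g := fun j => (Nat.factorial (l j) : ℂ))]
    · simp [Nat.factorial_succ, mul_assoc]
    · intro j hj
      simp [Pi.single_eq_of_ne (Finset.ne_of_mem_erase hj)]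
  rw [h, mchoose, mul_div_mul_left _ _ (Nat.cast_add_one_ne_zero _)]

theorem sub_single_add_single {m : ℕ} {k : Fin m → ℕ} {i : Fin m} (hi : k i ≠ 0) :
    k - Pi.single i 1 + Pi.single i 1 = k := by
  refine tsub_add_cancel_of_le fun j => ?_
  rcases eq_or_ne j i with rfl | hj
  · simpa using Nat.one_le_iff_ne_zero.2 hi
  · simp [Pi.single_eq_of_ne hj]

/-- Pascal's rule for multinomial coefficients. -/
theorem mchoose_add_one {m : ℕ} (x : ℂ) (k : Fin m → ℕ) :
    mchoose (x + 1) k =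
      mchoose x k + ∑ i, if k i = 0 then 0 else mchoose x (k - Pi.single i 1) := by
  have h : ∀ i, (if k i = 0 then 0 else mchoose x (k - Pi.single i 1)) =
      (k i : ℂ) * ((∏ j ∈ Finset.range (∑ i, k i - 1), (x - (j : ℂ))) /
        ∏ j, (Nat.factorial (k j) : ℂ)) := by
    intro i
    split_ifs with hi
    · simp [hi]
    · have hk := sub_single_add_single hi
      generalize k - Pi.single i 1 = l at hk ⊢
      subst hk
      rw [← mchoose_add_single x l i, ← mul_div_assoc]
      simp [Finset.sum_add_distrib]
  rw [Finset.sum_congr rfl fun i _ => h i, ← Finset.sum_mul, mchoose, mchoose,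
    prod_range_add_one_sub]
  push_cast
  ring

theorem sum_Iic_sub_single {m : ℕ} (n : Fin m → ℕ) (i : Fin m)
    (f : (Fin m → ℕ) → (Fin m → ℕ) → ℂ) :
    (∑ k ∈ Finset.Iic n, if k i = 0 then 0 else f k (k - Pi.single i 1)) =
      if n i = 0 then 0 else
        ∑ k ∈ Finset.Iic (n - Pi.single i 1), f (k + Pi.single i 1) k := by
  split_ifs with hn
  · refine Finset.sum_eq_zero fun k hk => if_pos ?_
    exact Nat.le_zero.1 (hn ▸ Finset.mem_Iic.1 hk i)
  · have hn' := sub_single_add_single hn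
    rw [Finset.sum_ite, Finset.sum_const_zero, zero_add]
    refine Finset.sum_nbij' (fun k => k - Pi.single i 1) (fun k => k + Pi.single i 1)
      ?_ ?_ ?_ ?_ ?_
    · intro k hk
      rw [Finset.mem_filter, Finset.mem_Iic] at hk
      exact Finset.mem_Iic.2 (tsub_le_tsub_right hk.1 _)
    · intro k hk
      rw [Finset.mem_filter, Finset.mem_Iic]
      refine ⟨?_, by simp⟩
      rw [← hn']
      exact add_le_add_left (Finset.mem_Iic.1 hk) _
    · intro k hk
      exact sub_single_add_single (Finset.mem_filter.1 hk).2
    · intro k _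
      exact add_tsub_cancel_right _ _
    · intro k hk
      rw [sub_single_add_single (Finset.mem_filter.1 hk).2]

theorem sum_Iic_sub_sub_single {m : ℕ} (n : Fin m → ℕ) (i : Fin m)
    (f : (Fin m → ℕ) → (Fin m → ℕ) → ℂ) :
    (∑ k ∈ Finset.Iic n, if (n - k) i = 0 then 0 else f k (n - k - Pi.single i 1)) =
      if n i = 0 then 0 else
        ∑ k ∈ Finset.Iic (n - Pi.single i 1), f k (n - Pi.single i 1 - k) := by
  split_ifs with hn
  · exact Finset.sum_eq_zero fun k _ => if_pos (by simp [hn])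
  · rw [Finset.sum_ite, Finset.sum_const_zero, zero_add]
    refine Finset.sum_congr ?_ fun k _ => by rw [tsub_right_comm]
    ext k
    simp only [Finset.mem_filter, Finset.mem_Iic, Pi.le_def, Pi.sub_apply]
    constructor
    · rintro ⟨h, hi⟩ j
      rcases eq_or_ne j i with rfl | hj
      · simp only [Pi.single_eq_same]
        omega
      · simpa [Pi.single_eq_of_ne hj] using h j
    · intro h
      refine ⟨fun j => (h j).trans (Nat.sub_le _ _), ?_⟩
      have := h i
      simp only [Pi.single_eq_same] at this
      omega

/-- The convolution sum in the Gould–Mohanty identity. -/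
noncomputable def gouldMohantySum {m : ℕ} (z n : Fin m → ℕ) (x y : ℂ) : ℂ :=
  ∑ k ∈ Finset.Iic n, mchoose (x - (mdot k z : ℂ)) k * mchoose (y + (mdot k z : ℂ)) (n - k)

theorem mdot_add_single {m : ℕ} (k z : Fin m → ℕ) (i : Fin m) :
    mdot (k + Pi.single i 1) z = mdot k z + z i := by
  simp [mdot, add_mul, Finset.sum_add_distrib, Pi.single_apply]

theorem gouldMohantySum_add_one_left {m : ℕ} (z n : Fin m → ℕ) (x y : ℂ) :
    gouldMohantySum z n (x + 1) y = gouldMohantySum z n x y +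
      ∑ i, if n i = 0 then 0 else
        gouldMohantySum z (n - Pi.single i 1) (x - z i) (y + z i) := by
  simp only [gouldMohantySum, add_sub_right_comm x 1, mchoose_add_one, add_mul,
    Finset.sum_add_distrib, Finset.sum_mul, ite_mul, zero_mul]
  rw [Finset.sum_comm]
  congr 1
  refine Finset.sum_congr rfl fun i _ => ?_
  rw [sum_Iic_sub_single n i fun k l =>
    mchoose (x - (mdot k z : ℂ)) l * mchoose (y + (mdot k z : ℂ)) (n - k)]
  refine if_congr Iff.rfl rfl (Finset.sum_congr rfl fun k _ => ?_)
  rw [mdot_add_single, add_comm k, tsub_add_eq_tsub_tsub]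
  push_cast
  congr 2 <;> ring

theorem gouldMohantySum_add_one_right {m : ℕ} (z n : Fin m → ℕ) (x y : ℂ) :
    gouldMohantySum z n x (y + 1) = gouldMohantySum z n x y +
      ∑ i, if n i = 0 then 0 else gouldMohantySum z (n - Pi.single i 1) x y := by
  simp only [gouldMohantySum, add_right_comm y 1, mchoose_add_one, mul_add,
    Finset.sum_add_distrib, Finset.mul_sum, mul_ite, mul_zero]
  rw [Finset.sum_comm]
  congr 1
  refine Finset.sum_congr rfl fun i _ => ?_
  exact sum_Iic_sub_sub_single n i fun k l =>
    mchoose (x - (mdot k z : ℂ)) k * mchoose (y + (mdot k z : ℂ)) l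

theorem gouldMohantySum_add_one {m : ℕ} (z n : Fin m → ℕ) (x y : ℂ) :
    gouldMohantySum z n (x + 1) y = gouldMohantySum z n x (y + 1) := by
  induction hN : ∑ i, n i generalizing n x y with
  | zero =>
    have hn : ∀ i, n i = 0 := fun i => (Finset.sum_eq_zero_iff.1 hN) i (Finset.mem_univ i)
    simp [gouldMohantySum_add_one_left, gouldMohantySum_add_one_right, hn]
  | succ N ih =>
    rw [gouldMohantySum_add_one_left, gouldMohantySum_add_one_right]
    congr 1
    refine Finset.sum_congr rfl fun i _ => ?_
    split_ifs with hi
    · rfl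
    have hs : ∑ j, (n - Pi.single i 1 : Fin m → ℕ) j = N := by
      have h := congrArg (fun k : Fin m → ℕ => ∑ j, k j) (sub_single_add_single hi)
      simp only [Pi.add_apply, Finset.sum_add_distrib, Finset.sum_pi_single',
        Finset.mem_univ, if_true, hN] at h
      omega
    have shift : ∀ t : ℕ, gouldMohantySum z (n - Pi.single i 1) (x - t) (y + t) =
        gouldMohantySum z (n - Pi.single i 1) x y := by
      intro t
      induction t with
      | zero => simp
      | succ t iht =>
        rw [← iht]
        have h := ih (n - Pi.single i 1) (x - (t + 1)) (y + t) hs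
        push_cast
        rw [← add_assoc, ← h]
        congr 1
        ring
    exact shift (z i)

/-- **Gould–Mohanty's identity, special case** (equation (2.1) of the paper):
for natural numbers `p ≥ n·z` and `q ≥ 1`,
`∑_{k=0}^{n} C(p − k·z, k) · C(q + k·z, n − k)
  = ∑_{k=0}^{n} C(p + 1 − k·z, k) · C(q − 1 + k·z, n − k)`,
where the multinomial coefficients are evaluated at the (possibly negative)
integers `p − k·z` and `p + 1 − k·z` via the polynomial definition. -/
theorem gould_mohanty_special (m : ℕ) (hm : 0 < m) (n z : Fin m → ℕ) (p q : ℕ)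
    (hp : mdot n z ≤ p) (hq : 1 ≤ q) :
    ∑ k ∈ Finset.Iic n,
        mchoose ((p : ℂ) - (mdot k z : ℂ)) k * mchoose ((q : ℂ) + (mdot k z : ℂ)) (n - k) =
      ∑ k ∈ Finset.Iic n,
        mchoose ((p : ℂ) + 1 - (mdot k z : ℂ)) k *
          mchoose ((q : ℂ) - 1 + (mdot k z : ℂ)) (n - k) := by
  have h := gouldMohantySum_add_one z n p (q - 1)
  rw [sub_add_cancel] at h
  exact h.symm
end

section
/- For every n ∈ ℕ, z ∈ ℕ, and complex numbers x, y, ε, one has ∑_{k=0}^{n} C(x − kz, k) · C(y + kz, n − k) = ∑_{k=0}^{n} C(x + ε − kz, k) · C(y − ε + kz, n − k) (Gould's identity). -/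
/-- The generalized binomial coefficient `C(x, k) = x(x-1)⋯(x-k+1)/k!` for `x : ℂ`. -/
noncomputable def cchoose (x : ℂ) (k : ℕ) : ℂ :=
  (∏ j ∈ Finset.range k, (x - (j : ℂ))) / (Nat.factorial k : ℂ)

theorem cchoose_zero_right (x : ℂ) : cchoose x 0 = 1 := by
  simp [cchoose]

/-- Pascal's rule for the generalized binomial coefficient. -/
theorem cchoose_add_one_succ (x : ℂ) (k : ℕ) :
    cchoose (x + 1) (k + 1) = cchoose x (k + 1) + cchoose x k := by
  have h : ∏ j ∈ Finset.range k, (x + 1 - ((j + 1 : ℕ) : ℂ)) =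
      ∏ j ∈ Finset.range k, (x - (j : ℂ)) :=
    Finset.prod_congr rfl fun j _ => by push_cast; ring
  have hk : (k : ℂ) + 1 ≠ 0 := by exact_mod_cast k.succ_ne_zero
  have hf : (k.factorial : ℂ) ≠ 0 := by exact_mod_cast k.factorial_ne_zero
  unfold cchoose
  rw [Finset.prod_range_succ', h, Finset.prod_range_succ, Nat.factorial_succ]
  push_cast
  field_simp
  ring

/-- Substituting a polynomial into a generalized binomial coefficient yields a polynomial. -/
theorem exists_polynomial_eval_eq_cchoose (p : Polynomial ℂ) (k : ℕ) :
    ∃ q : Polynomial ℂ, ∀ t, q.eval t = cchoose (p.eval t) k :=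
  ⟨Polynomial.C (k.factorial : ℂ)⁻¹ * ∏ j ∈ Finset.range k, (p - Polynomial.C (j : ℂ)), fun t => by
    simp [cchoose, Polynomial.eval_prod, div_eq_inv_mul]⟩

/-- The convolution sum in Gould's identity. -/
noncomputable def gouldSum (z n : ℕ) (x y : ℂ) : ℂ :=
  ∑ k ∈ Finset.range (n + 1),
    cchoose (x - (k * z : ℕ)) k * cchoose (y + (k * z : ℕ)) (n - k)

theorem gouldSum_add_one_left (z n : ℕ) (x y : ℂ) :
    gouldSum z (n + 1) (x + 1) y = gouldSum z (n + 1) x y + gouldSum z n (x - z) (y + z) := by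
  unfold gouldSum
  rw [Finset.sum_range_succ', Finset.sum_range_succ' _ (n + 1), add_right_comm,
    ← Finset.sum_add_distrib]
  congr 1
  refine Finset.sum_congr rfl fun k _ => ?_
  rw [add_sub_right_comm, cchoose_add_one_succ, add_mul, Nat.add_sub_add_right]
  push_cast
  ring_nf

theorem gouldSum_add_one_right (z n : ℕ) (x y : ℂ) :
    gouldSum z (n + 1) x (y + 1) = gouldSum z (n + 1) x y + gouldSum z n x y := by
  unfold gouldSum
  rw [Finset.sum_range_succ, Finset.sum_range_succ _ (n + 1), add_right_comm (∑ _ ∈ _, _),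
    ← Finset.sum_add_distrib]
  congr 1
  · refine Finset.sum_congr rfl fun k hk => ?_
    rw [Nat.succ_sub (Finset.mem_range_succ_iff.mp hk), add_right_comm, cchoose_add_one_succ,
      mul_add]
  · simp [cchoose_zero_right]

theorem exists_polynomial_eval_eq_gouldSum (z n : ℕ) (x y : ℂ) :
    ∃ q : Polynomial ℂ, ∀ t, q.eval t = gouldSum z n (x + t) (y - t) := by
  choose f hf using exists_polynomial_eval_eq_cchoose
  refine ⟨∑ k ∈ Finset.range (n + 1),
    f (Polynomial.C x + Polynomial.X - Polynomial.C ((k * z : ℕ) : ℂ)) k *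
      f (Polynomial.C y - Polynomial.X + Polynomial.C ((k * z : ℕ) : ℂ)) (n - k), fun t => ?_⟩
  simp only [gouldSum, Polynomial.eval_finsetSum, Polynomial.eval_mul, hf, Polynomial.eval_add,
    Polynomial.eval_sub, Polynomial.eval_C, Polynomial.eval_X]

/-- A complex polynomial that is invariant under translation by one is constant. -/
theorem Polynomial.eval_eq_eval_zero_of_eval_add_one {q : Polynomial ℂ}
    (h : ∀ t, q.eval (t + 1) = q.eval t) (t : ℂ) : q.eval t = q.eval 0 := by
  have hnat (m : ℕ) : q.eval (m : ℂ) = q.eval 0 := by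
    induction m with
    | zero => simp
    | succ m ih => rw [Nat.cast_succ, h, ih]
  have hq : q = Polynomial.C (q.eval 0) := by
    refine Polynomial.eq_of_infinite_eval_eq _ _
      ((Set.infinite_range_of_injective (Nat.cast_injective (R := ℂ))).mono ?_)
    rintro _ ⟨m, rfl⟩
    simpa using hnat m
  rw [hq]
  simp

theorem gouldSum_add_sub (z n : ℕ) (x y t : ℂ) :
    gouldSum z n (x + t) (y - t) = gouldSum z n x y := by
  induction n generalizing x y t with
  | zero => simp [gouldSum, cchoose_zero_right]
  | succ n ih =>
    have hshift (a b : ℂ) : gouldSum z (n + 1) (a + 1) b = gouldSum z (n + 1) a (b + 1) := by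
      have h := ih a b (-z)
      rw [← sub_eq_add_neg, sub_neg_eq_add] at h
      rw [gouldSum_add_one_left, gouldSum_add_one_right, h]
    obtain ⟨q, hq⟩ := exists_polynomial_eval_eq_gouldSum z (n + 1) x y
    have h := Polynomial.eval_eq_eval_zero_of_eval_add_one (q := q) (fun s => by
      rw [hq, hq, ← add_assoc, hshift, sub_add_eq_sub_sub, sub_add_cancel]) t
    simpa [hq] using h

/-- **Gould's identity.** -/
theorem gould (n z : ℕ) (x y ε : ℂ) :
    ∑ k ∈ Finset.range (n + 1),
        cchoose (x - (k * z : ℕ)) k * cchoose (y + (k * z : ℕ)) (n - k) =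
      ∑ k ∈ Finset.range (n + 1),
        cchoose (x + ε - (k * z : ℕ)) k * cchoose (y - ε + (k * z : ℕ)) (n - k) := by
  exact (gouldSum_add_sub z n x y ε).symm
end
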